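/- For n ≥ 1 and A ⊆ {1,...,n} sum-free, at least one of the following holds: |A| ≤ 2n/5 + 1, or every element of A is odd, or |A| ≤ min(A). -/

import Mathlib

open Finset
open scoped Pointwise

/-- Among the nonempty sets `X` with `X + S ≠ G`, some subgroup minimises `|X + S| - |X|`. -/
theorem exists_addSubgroup_isoperimetric {G : Type*} [AddCommGroup G] [Fintype G] [DecidableEq G]
    (S : Finset G) {X₀ : Finset G} (hX₀ : X₀.Nonempty) (hX₀S : X₀ + S ≠ univ) :
    ∃ (H : AddSubgroup G) (F : Finset G), (∀ x, x ∈ F ↔ x ∈ H) ∧ F + S ≠ univ ∧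
      ∀ X : Finset G, X.Nonempty → X + S ≠ univ → #(F + S) + #X ≤ #(X + S) + #F := by
  classical
  let c : Finset G → ℤ := fun X => (#(X + S) : ℤ) - #X
  let 𝒱 : Finset (Finset G) := univ.filter fun X => X.Nonempty ∧ X + S ≠ univ
  have mem𝒱 : ∀ X, X ∈ 𝒱 ↔ X.Nonempty ∧ X + S ≠ univ := fun X => by simp [𝒱]
  obtain ⟨Y, hY, hYmin⟩ := 𝒱.exists_min_image c ⟨X₀, (mem𝒱 _).2 ⟨hX₀, hX₀S⟩⟩
  obtain ⟨M, hM, hMmin⟩ := (𝒱.filter fun X => c X = c Y).exists_min_image card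
    ⟨Y, by simp [hY]⟩
  simp only [mem_filter] at hM hMmin
  obtain ⟨hM𝒱, hMc⟩ := hM
  have hcle : ∀ X ∈ 𝒱, c M ≤ c X := fun X hX => hMc ▸ hYmin X hX
  have hcard : ∀ X ∈ 𝒱, c X ≤ c M → #M ≤ #X := fun X hX h =>
    hMmin X ⟨hX, le_antisymm (h.trans hMc.le) (hYmin X hX)⟩
  obtain ⟨⟨z, hz⟩, hMS⟩ := (mem𝒱 M).1 hM𝒱
  -- the reflected complement of `M + S` is also a minimiser
  have hcompl : 2 * (#M : ℤ) + c M ≤ Fintype.card G := by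
    set Z := -(M + S)ᶜ with hZ
    have hZcard : #Z = Fintype.card G - #(M + S) := by rw [hZ, card_neg, card_compl]
    have hle : #(M + S) ≤ Fintype.card G := card_le_univ _
    have hZS : Z + S ⊆ (-M)ᶜ := by
      intro w hw
      obtain ⟨x, hx, s, hs, rfl⟩ := mem_add.1 hw
      rw [hZ, mem_neg'] at hx
      simp only [mem_compl, mem_neg'] at hx ⊢
      exact fun h => hx (mem_add.2 ⟨_, h, s, hs, by abel⟩)
    have hZScard : #(Z + S) ≤ Fintype.card G - #M := by
      simpa [card_compl] using card_le_card hZS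
    have hMle : #M ≤ Fintype.card G := card_le_univ _
    have hZ𝒱 : Z ∈ 𝒱 := by
      refine (mem𝒱 _).2 ⟨?_, fun h => ?_⟩
      · rw [hZ, neg_nonempty_iff, nonempty_iff_ne_empty, Ne, compl_eq_empty_iff]
        exact hMS
      · have := hZS (h ▸ mem_univ (-z))
        simp [hz] at this
    have := hcard Z hZ𝒱 (by simp only [c]; omega)
    simp only [c]
    omega
  have htrans : ∀ g : G, (g +ᵥ M) ∈ 𝒱 ∧ c (g +ᵥ M) = c M := by
    intro g
    have h : (g +ᵥ M) + S = g +ᵥ (M + S) := vadd_add_assoc g M S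
    refine ⟨(mem𝒱 _).2 ⟨⟨g +ᵥ z, by simpa using hz⟩, fun h' => hMS ?_⟩, ?_⟩
    · rw [h] at h'
      rw [← card_eq_iff_eq_univ] at h' ⊢
      simpa using h'
    · simp only [c, h, card_vadd_finset]
  have hinter : ∀ N ∈ 𝒱, c N = c M → #N = #M → (M ∩ N).Nonempty → M ⊆ N := by
    intro N hN hNc hNM hne
    by_contra hsub
    have hlt : #(M ∩ N) < #M := card_lt_card
      ⟨inter_subset_left, fun h => hsub (h.trans inter_subset_right)⟩
    have hi : (M ∩ N) + S ⊆ (M + S) ∩ (N + S) := inter_add_subset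
    have hu : (M ∪ N) + S = (M + S) ∪ (N + S) := union_add
    have hI𝒱 : M ∩ N ∈ 𝒱 := (mem𝒱 _).2 ⟨hne, fun h => hMS (univ_subset_iff.1
      (h ▸ hi.trans inter_subset_left))⟩
    have h1 : c M < c (M ∩ N) := by
      by_contra! h
      exact absurd (hcard _ hI𝒱 h) (by omega)
    have h2 := card_le_card hi
    have h3 := card_union_add_card_inter (M + S) (N + S)
    have h4 := card_union_add_card_inter M N
    rw [← hu] at h3
    have h5 : c (M ∪ N) < c M := by simp only [c] at *; omega
    have h6 : (M ∪ N) + S = univ := by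
      by_contra h
      exact absurd (hcle _ ((mem𝒱 _).2 ⟨hne.mono (inter_subset_left.trans subset_union_left), h⟩))
        (by omega)
    have h7 : #((M ∪ N) + S) = Fintype.card G := by rw [h6, card_univ]
    have h8 : 0 < #(M ∩ N) := hne.card_pos
    simp only [c] at *
    omega
  have hclosed : ∀ x ∈ M, ∀ y ∈ M, ∀ w ∈ M, x - y + w ∈ M := by
    intro x hx y hy w hw
    obtain ⟨h1, h2⟩ := htrans (y - x)
    have := hinter _ h1 h2 (by simp) ⟨y, by
      simp only [mem_inter, hy, true_and]
      exact mem_vadd_finset.2 ⟨x, hx, by simp⟩⟩ hw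
    obtain ⟨v, hv, hvw⟩ := mem_vadd_finset.1 this
    rw [← hvw]
    convert hv using 1
    rw [vadd_eq_add]
    abel
  obtain ⟨hF𝒱, hFc⟩ := htrans (-z)
  have memF : ∀ x, x ∈ (-z) +ᵥ M ↔ x + z ∈ M := by
    intro x
    rw [← neg_vadd_mem_iff]
    simp [add_comm]
  refine ⟨{ carrier := {x | x + z ∈ M}
            zero_mem' := by simpa using hz
            add_mem' := fun {x y} hx hy => ?_
            neg_mem' := fun {x} hx => ?_ }, (-z) +ᵥ M, memF, ((mem𝒱 _).1 hF𝒱).2, ?_⟩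
  · have := hclosed _ hx z hz _ hy
    simp only [Set.mem_ofPred_eq]
    convert this using 1
    abel
  · have := hclosed z hz _ hx z hz
    simp only [Set.mem_ofPred_eq]
    convert this using 1
    abel
  · intro X hX hXS
    have := hcle X ((mem𝒱 _).2 ⟨hX, hXS⟩)
    rw [← hFc] at this
    simp only [c] at this
    omega

/-- Reducing a set in `[-L, L)` modulo `L` loses one element for each pair `x`, `x - L`. -/
theorem card_eq_card_image_zmod_add {L : ℕ} {E : Finset ℤ} (hE : ∀ x ∈ E, -(L : ℤ) ≤ x ∧ x < L) :
    #E = #(E.image (Int.cast : ℤ → ZMod L)) + #(E.filter fun x => 0 ≤ x ∧ x - (L : ℤ) ∈ E) := by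
  set P := E.filter fun x => 0 ≤ x with hP
  set N := E.filter fun x => ¬ 0 ≤ x with hN
  set N' := N.image (fun x => x + (L : ℤ)) with hN'
  have hPN : #P + #N = #E := card_filter_add_card_filter_not _
  have hNN' : #N' = #N := card_image_of_injective _ (add_left_injective _)
  have hQ : E.filter (fun x => 0 ≤ x ∧ x - (L : ℤ) ∈ E) = P ∩ N' := by
    ext x
    simp only [hP, hN', hN, mem_filter, mem_inter, mem_image]
    constructor
    · rintro ⟨hx, hx0, hxL⟩
      exact ⟨⟨hx, hx0⟩, x - L, ⟨hxL, by have := hE x hx; omega⟩, by ring⟩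
    · rintro ⟨⟨hx, hx0⟩, y, ⟨hy, -⟩, rfl⟩
      exact ⟨hx, hx0, by simpa using hy⟩
  have himage : E.image (Int.cast : ℤ → ZMod L) = (P ∪ N').image Int.cast := by
    rw [image_union, hN', image_image]
    have : N.image ((Int.cast : ℤ → ZMod L) ∘ fun x => x + (L : ℤ)) = N.image Int.cast :=
      image_congr fun x _ => by simp
    rw [this, ← image_union, hP, hN, filter_union_filter_not_eq]
  have hrange : ∀ x ∈ P ∪ N', 0 ≤ x ∧ x < L := by
    intro x hx
    simp only [hP, hN', hN, mem_union, mem_filter, mem_image] at hx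
    rcases hx with ⟨hx, hx0⟩ | ⟨y, ⟨hy, hy0⟩, rfl⟩
    · exact ⟨hx0, (hE x hx).2⟩
    · have := hE y hy
      omega
  have hinj : Set.InjOn (Int.cast : ℤ → ZMod L) (P ∪ N' : Finset ℤ) := by
    intro x hx y hy hxy
    obtain ⟨hx0, hxL⟩ := hrange x hx
    obtain ⟨hy0, hyL⟩ := hrange y hy
    have := (ZMod.intCast_eq_intCast_iff' x y L).1 hxy
    rwa [Int.emod_eq_of_lt hx0 hxL, Int.emod_eq_of_lt hy0 hyL] at this
  rw [himage, card_image_of_injOn hinj, hQ, card_union_add_card_inter]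
  omega

/-- A subgroup of `ZMod L` containing the images of integers without common divisor is everything. -/
theorem ZMod.addSubgroup_eq_top_of_forall_dvd {L : ℕ} {A : Set ℤ}
    (hgcd : ∀ d : ℤ, (∀ x ∈ A, d ∣ x) → IsUnit d) (T : AddSubgroup (ZMod L))
    (hT : ∀ x ∈ A, (x : ZMod L) ∈ T) : T = ⊤ := by
  obtain ⟨d, hd⟩ := Int.subgroup_cyclic (T.comap (Int.castAddHom (ZMod L)))
  rw [← AddSubgroup.zmultiples_eq_closure] at hd
  have hmem : ∀ x : ℤ, (x : ZMod L) ∈ T ↔ d ∣ x := fun x => by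
    rw [← Int.mem_zmultiples_iff, ← hd]
    rfl
  have hunit := hgcd d fun x hx => (hmem x).1 (hT x hx)
  rw [eq_top_iff]
  intro y _
  obtain ⟨x, rfl⟩ := ZMod.intCast_surjective y
  exact (hmem x).2 hunit.dvd

/-- Freiman's `3k - 3` theorem for difference sets. -/
theorem card_add_le_card_sub_or {A : Finset ℤ} {L : ℕ} (hL : 0 < L) (h0A : 0 ∈ A)
    (hLA : (L : ℤ) ∈ A) (hA : ∀ x ∈ A, 0 ≤ x ∧ x ≤ L)
    (hgcd : ∀ d : ℤ, (∀ x ∈ A, d ∣ x) → IsUnit d) :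
    #A + L ≤ #(A - A) ∨ 3 * #A ≤ #(A - A) + 3 := by
  classical
  have : NeZero L := ⟨hL.ne'⟩
  let π : ℤ → ZMod L := Int.cast
  have hπsub : ∀ x y, π (x - y) = π x - π y := fun x y => Int.cast_sub x y
  set B := A.erase (L : ℤ) with hB
  have hBcard : #B + 1 = #A := card_erase_add_one hLA
  have hBA : ∀ x ∈ B, x ∈ A := fun x hx => mem_of_mem_erase hx
  have hBL : ∀ x ∈ B, 0 ≤ x ∧ x < L := fun x hx => by
    have := hA x (hBA x hx)
    have := ne_of_mem_erase hx
    omega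
  have h0B : (0 : ℤ) ∈ B := mem_erase.2 ⟨by omega, h0A⟩
  set S := B.image π with hS
  have hSA : ∀ x ∈ A, π x ∈ S := by
    intro x hx
    by_cases h : x = L
    · exact mem_image.2 ⟨0, h0B, by simp [π, h]⟩
    · exact mem_image_of_mem _ (mem_erase.2 ⟨h, hx⟩)
  have hScard : #S = #B := by
    have h := card_eq_card_image_zmod_add (L := L) (E := B)
      (fun x hx => by have := hBL x hx; omega)
    have hempty : (B.filter fun x => 0 ≤ x ∧ x - (L : ℤ) ∈ B) = ∅ := by
      refine filter_eq_empty_iff.2 ?_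
      rintro x hx ⟨-, hx'⟩
      have := hBL x hx
      have := hBL _ hx'
      omega
    rw [hempty, card_empty] at h
    exact h.symm
  set D := (A - A).erase (L : ℤ) with hD
  have hLD : (L : ℤ) ∈ A - A := mem_sub.2 ⟨L, hLA, 0, h0A, by simp⟩
  have hDcard : #D + 1 = #(A - A) := card_erase_add_one hLD
  have hDL : ∀ x ∈ D, -(L : ℤ) ≤ x ∧ x < L := by
    intro x hx
    obtain ⟨hne, hx⟩ := mem_erase.1 hx
    obtain ⟨y, hy, z, hz, rfl⟩ := mem_sub.1 hx
    have := hA y hy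
    have := hA z hz
    omega
  set Q := D.filter fun x => 0 ≤ x ∧ x - (L : ℤ) ∈ D with hQ
  have hsub : ∀ x ∈ A, ∀ y ∈ A, x - y ≠ L → x - y ∈ D := fun x hx y hy h =>
    mem_erase.2 ⟨h, sub_mem_sub hx hy⟩
  have hBQ : B ⊆ Q := by
    intro x hx
    have h := hBL x hx
    refine mem_filter.2 ⟨?_, h.1, hsub x (hBA x hx) L hLA (by omega)⟩
    simpa using hsub x (hBA x hx) 0 h0A (by omega)
  have hDQ := card_eq_card_image_zmod_add hDL
  rw [← hQ] at hDQ
  have hDimage : -S + S ⊆ D.image π := by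
    rw [add_comm, ← sub_eq_add_neg]
    intro r hr
    obtain ⟨_, hs, _, ht, rfl⟩ := mem_sub.1 hr
    obtain ⟨x, hx, rfl⟩ := mem_image.1 hs
    obtain ⟨y, hy, rfl⟩ := mem_image.1 ht
    have := hBL x hx
    have := hBL y hy
    exact mem_image.2 ⟨x - y, hsub x (hBA x hx) y (hBA y hy) (by omega), hπsub x y⟩
  have hR := card_le_card hDimage
  have hSne : S.Nonempty := ⟨_, mem_image_of_mem π h0B⟩
  by_cases hfull : -S + S = univ
  · left
    have := card_le_card hBQ
    rw [hfull, card_univ, ZMod.card] at hR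
    change _ ≤ #(D.image Int.cast) at hR
    omega
  right
  obtain ⟨H, F, hF, hFS, hmin⟩ := exists_addSubgroup_isoperimetric S hSne.neg hfull
  have hRF := hmin (-S) hSne.neg hfull
  rw [card_neg, hScard] at hRF
  -- some difference of elements of `S` lies outside `H + S`
  have hex : ∃ s₁ ∈ S, ∃ s₂ ∈ S, s₁ - s₂ ∉ F + S := by
    by_contra! hall
    have hclosed : ∀ x ∈ F + S, ∀ y ∈ F + S, x - y ∈ F + S := by
      intro x hx y hy
      obtain ⟨f, hf, s, hs, rfl⟩ := mem_add.1 hx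
      obtain ⟨g, hg, t, ht, rfl⟩ := mem_add.1 hy
      obtain ⟨e, he, u, hu, heu⟩ := mem_add.1 (hall s hs t ht)
      refine mem_add.2 ⟨f - g + e, (hF _).2 (H.add_mem (H.sub_mem ((hF _).1 hf) ((hF _).1 hg))
        ((hF _).1 he)), u, hu, ?_⟩
      rw [add_assoc, heu]
      abel
    obtain ⟨s, hs⟩ := hSne
    have hSF : ∀ s ∈ S, s ∈ F + S := fun s hs =>
      mem_add.2 ⟨0, (hF _).2 H.zero_mem, s, hs, zero_add s⟩
    have h0 : (0 : ZMod L) ∈ F + S := by simpa using hclosed s (hSF s hs) s (hSF s hs)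
    have hneg : ∀ x ∈ F + S, -x ∈ F + S := fun x hx => by simpa using hclosed 0 h0 x hx
    let T : AddSubgroup (ZMod L) :=
      { carrier := (F + S : Finset (ZMod L))
        zero_mem' := mem_coe.2 h0
        add_mem' := fun {x y} hx hy => by
          have := hclosed x (mem_coe.1 hx) _ (hneg y (mem_coe.1 hy))
          rw [sub_neg_eq_add] at this
          exact mem_coe.2 this
        neg_mem' := fun {x} hx => mem_coe.2 (hneg x (mem_coe.1 hx)) }
    have hTtop : T = ⊤ := ZMod.addSubgroup_eq_top_of_forall_dvd (A := (A : Set ℤ))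
      (fun d hd => hgcd d fun x hx => hd x (mem_coe.2 hx)) T
      fun x hx => mem_coe.2 (hSF _ (hSA x (mem_coe.1 hx)))
    refine hFS (eq_univ_of_forall fun x => ?_)
    have : x ∈ T := hTtop ▸ AddSubgroup.mem_top x
    exact mem_coe.1 this
  obtain ⟨s₁, hs₁, s₂, hs₂, hs⟩ := hex
  have h0S : (0 : ZMod L) ∈ S := mem_image.2 ⟨0, h0B, Int.cast_zero⟩
  have hsH : s₁ - s₂ ∉ H := fun h => hs (mem_add.2 ⟨_, (hF _).2 h, 0, h0S, add_zero _⟩)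
  let C : ZMod L → Finset ℤ := fun s => B.filter fun x => π x - s ∈ H
  have hCmem : ∀ s x, x ∈ C s ↔ x ∈ B ∧ π x - s ∈ H := fun s x => mem_filter
  have hCne : ∀ s ∈ S, (C s).Nonempty := by
    intro s hs
    obtain ⟨x, hx, rfl⟩ := mem_image.1 hs
    exact ⟨x, (hCmem _ _).2 ⟨hx, by simp⟩⟩
  have hCdisj : Disjoint (C s₁) (C s₂) := by
    rw [disjoint_left]
    intro x h1 h2
    have := H.sub_mem ((hCmem _ _).1 h2).2 ((hCmem _ _).1 h1).2
    exact hsH (by simpa using this)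
  have hFcoset : ∀ s, #(F.image (· + s)) = #F := fun s =>
    card_image_of_injective _ (add_left_injective s)
  have hBcount : #B + 2 * #F ≤ #(C s₁) + #(C s₂) + #(F + S) := by
    have hsub1 : ∀ s ∈ S, F.image (· + s) ⊆ F + S := fun s hs x hx => by
      obtain ⟨f, hf, rfl⟩ := mem_image.1 hx
      exact add_mem_add hf hs
    have hd : Disjoint (F.image (· + s₁)) (F.image (· + s₂)) := by
      rw [disjoint_left]
      intro x h1 h2
      obtain ⟨f, hf, rfl⟩ := mem_image.1 h1
      obtain ⟨g, hg, hfg⟩ := mem_image.1 h2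
      refine hsH ?_
      have := H.sub_mem ((hF _).1 hg) ((hF _).1 hf)
      convert this using 1
      rw [sub_eq_sub_iff_add_eq_add, add_comm, ← hfg]
    have hrest : #((B \ (C s₁ ∪ C s₂)).image π) ≤
        #((F + S) \ (F.image (· + s₁) ∪ F.image (· + s₂))) := by
      refine card_le_card fun r hr => ?_
      obtain ⟨x, hx, rfl⟩ := mem_image.1 hr
      simp only [mem_sdiff, mem_union, not_or, hCmem, not_and] at hx
      obtain ⟨hx, h1, h2⟩ := hx
      have hcos : ∀ s, π x ∈ F.image (· + s) → π x - s ∈ H := fun s h => by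
        obtain ⟨f, hf, hfx⟩ := mem_image.1 h
        rw [← hfx, add_sub_cancel_right]
        exact (hF _).1 hf
      simp only [mem_sdiff, mem_union, not_or]
      exact ⟨mem_add.2 ⟨0, (hF _).2 H.zero_mem, π x, mem_image_of_mem _ hx, zero_add _⟩,
        fun h => h1 hx (hcos _ h), fun h => h2 hx (hcos _ h)⟩
    have hinj : Set.InjOn π B := card_image_iff.1 hScard
    rw [card_image_of_injOn (hinj.mono (by simp)),
      card_sdiff_of_subset (union_subset (filter_subset _ _) (filter_subset _ _)),
      card_sdiff_of_subset (union_subset (hsub1 _ hs₁) (hsub1 _ hs₂)),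
      card_union_of_disjoint hCdisj, card_union_of_disjoint hd, hFcoset, hFcoset] at hrest
    have h2 := card_le_card (union_subset (hsub1 _ hs₁) (hsub1 _ hs₂))
    rw [card_union_of_disjoint hd, hFcoset, hFcoset] at h2
    omega
  set E := C s₁ - C s₂ with hE
  have hEmem : ∀ x ∈ E, x ∈ D ∧ -(L : ℤ) ≤ x ∧ x < L ∧ π x - (s₁ - s₂) ∈ H := by
    intro x hx
    obtain ⟨y, hy, z, hz, rfl⟩ := mem_sub.1 hx
    rw [hCmem] at hy hz
    have := hBL y hy.1
    have := hBL z hz.1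
    refine ⟨hsub y (hBA y hy.1) z (hBA z hz.1) (by omega), by omega, by omega, ?_⟩
    have := H.sub_mem hy.2 hz.2
    rw [hπsub]
    convert this using 1
    abel
  have hEcard : #(C s₁) + #(C s₂) ≤ #E + 1 := by
    have := cauchy_davenport_add_of_linearOrder_isCancelAdd (hCne s₁ hs₁) (hCne s₂ hs₂).neg
    rw [card_neg, ← sub_eq_add_neg, ← hE] at this
    omega
  have hEQ := card_eq_card_image_zmod_add (L := L) (E := E)
    fun x hx => ⟨(hEmem x hx).2.1, (hEmem x hx).2.2.1⟩
  have hEimage : #(E.image (Int.cast : ℤ → ZMod L)) ≤ #F := by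
    rw [← hFcoset (s₁ - s₂)]
    refine card_le_card fun r hr => ?_
    obtain ⟨x, hx, rfl⟩ := mem_image.1 hr
    exact mem_image.2 ⟨_, (hF _).2 (hEmem x hx).2.2.2, by simp [π]⟩
  set Q' := E.filter fun x => 0 ≤ x ∧ x - (L : ℤ) ∈ E with hQ'
  have hQ'Q : B ∪ Q' ⊆ Q := by
    refine union_subset hBQ fun x hx => ?_
    obtain ⟨hx, hx0, hxL⟩ := mem_filter.1 hx
    exact mem_filter.2 ⟨(hEmem x hx).1, hx0, (hEmem _ hxL).1⟩
  have hBQ' : Disjoint B Q' := by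
    rw [disjoint_left]
    intro x hx hx'
    have h := H.neg_mem (hEmem x (mem_filter.1 hx').1).2.2.2
    refine hs (mem_add.2 ⟨_, (hF _).2 h, π x, mem_image_of_mem _ hx, ?_⟩)
    abel
  have hcard := card_le_card hQ'Q
  rw [card_union_of_disjoint hBQ'] at hcard
  change _ ≤ #(D.image Int.cast) at hR
  omega

/-- If `A` avoids all sums `x + y = s` then its part in `[p, s - p]` has density at most `1/2`. -/
theorem two_mul_card_filter_le {A : Finset ℤ} {s : ℤ} (hs : ∀ x ∈ A, ∀ y ∈ A, x + y ≠ s) (p : ℤ) :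
    2 * #(A.filter fun x => p ≤ x ∧ x ≤ s - p) ≤ (s - 2 * p + 1).toNat := by
  set M := A.filter fun x => p ≤ x ∧ x ≤ s - p with hM
  have hd : Disjoint M (M.image (s - ·)) := by
    rw [disjoint_left]
    intro x hx hx'
    obtain ⟨y, hy, rfl⟩ := mem_image.1 hx'
    exact hs _ (mem_filter.1 hx).1 y (mem_filter.1 hy).1 (by ring)
  have hsub : M ∪ M.image (s - ·) ⊆ Icc p (s - p) := by
    intro x hx
    simp only [hM, mem_union, mem_image, mem_filter] at hx
    rw [mem_Icc]
    rcases hx with hx | ⟨y, hy, rfl⟩ <;> omega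
  have := card_le_card hsub
  rw [card_union_of_disjoint hd, card_image_of_injective _ sub_right_injective, Int.card_Icc] at this
  omega

/-- If `A` contains no two elements at distance `a`, it has at most `a` elements in a window of
length `2 * a`. -/
theorem card_filter_le_of_add_notMem {A : Finset ℤ} {a : ℤ} (ha : 0 ≤ a)
    (hsf : ∀ x ∈ A, x + a ∉ A) (p : ℤ) :
    (#(A.filter fun x => p - a < x ∧ x ≤ p + a) : ℤ) ≤ a := by
  set W := A.filter fun x => p - a < x ∧ x ≤ p + a with hW
  have hcard : #(W.filter fun x => x ≤ p) + #(W.filter fun x => ¬ x ≤ p) = #W :=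
    card_filter_add_card_filter_not _
  have hd : Disjoint (W.filter fun x => x ≤ p) ((W.filter fun x => ¬ x ≤ p).image (· - a)) := by
    rw [disjoint_left]
    intro x hx hx'
    obtain ⟨y, hy, rfl⟩ := mem_image.1 hx'
    simp only [hW, mem_filter] at hx hy
    exact hsf _ hx.1.1 (by simpa using hy.1.1)
  have hsub : (W.filter fun x => x ≤ p) ∪ ((W.filter fun x => ¬ x ≤ p).image (· - a)) ⊆
      Ioc (p - a) p := by
    intro x hx
    simp only [hW, mem_union, mem_image, mem_filter] at hx
    rw [mem_Ioc]
    rcases hx with hx | ⟨y, hy, rfl⟩ <;> omega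
  have := card_le_card hsub
  rw [card_union_of_disjoint hd, card_image_of_injective _ (sub_left_injective), Int.card_Ioc] at this
  omega

/-- The structure theorem for sets of integers that do not lie in a proper residue class. -/
theorem five_mul_card_le_or_card_le {A : Finset ℤ} {a m : ℤ} (ha : 0 < a) (haA : a ∈ A)
    (hmA : m ∈ A) (hA : ∀ x ∈ A, a ≤ x ∧ x ≤ m) (hsf : ∀ x ∈ A, ∀ y ∈ A, x + y ∉ A)
    (hgcd : ∀ d : ℤ, (∀ x ∈ A, d ∣ x - a) → IsUnit d) :
    5 * (#A : ℤ) ≤ 2 * m + 5 ∨ (#A : ℤ) ≤ a := by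
  by_contra! hcon
  obtain ⟨hk, hka⟩ := hcon
  have ham : a < m := by
    have := hA m hmA
    by_contra! h
    have : A ⊆ {a} := fun x hx => mem_singleton.2 (by have := hA x hx; omega)
    have := card_le_card this
    rw [card_singleton] at this
    omega
  obtain ⟨L, hL⟩ := Int.eq_ofNat_of_zero_le (sub_nonneg.2 ham.le)
  set B := A.image (· - a) with hB
  have hBcard : #B = #A := card_image_of_injective _ (sub_left_injective)
  have hBA : B - B = A - A := by
    ext x
    simp only [hB, mem_sub, mem_image]
    constructor
    · rintro ⟨_, ⟨y, hy, rfl⟩, _, ⟨z, hz, rfl⟩, rfl⟩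
      exact ⟨y, hy, z, hz, by ring⟩
    · rintro ⟨y, hy, z, hz, rfl⟩
      exact ⟨_, ⟨y, hy, rfl⟩, _, ⟨z, hz, rfl⟩, by ring⟩
  have hfreiman := card_add_le_card_sub_or (A := B) (L := L) (by omega)
    (mem_image.2 ⟨a, haA, sub_self a⟩) (mem_image.2 ⟨m, hmA, hL⟩)
    (fun x hx => by
      obtain ⟨y, hy, rfl⟩ := mem_image.1 hx
      have := hA y hy
      omega)
    (fun d hd => hgcd d fun x hx => hd _ (mem_image_of_mem _ hx))
  rw [hBA, hBcard] at hfreiman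
  set P := (A - A).filter fun x => 0 < x with hP
  have hDP : #(A - A) ≤ 2 * #P + 1 := by
    have hsub : A - A ⊆ (P ∪ P.image (- ·)) ∪ {0} := by
      intro x hx
      have hnx : -x ∈ A - A := by
        obtain ⟨y, hy, z, hz, rfl⟩ := mem_sub.1 hx
        exact mem_sub.2 ⟨z, hz, y, hy, by ring⟩
      simp only [hP, mem_union, mem_image, mem_filter, mem_singleton]
      rcases lt_trichotomy x 0 with h | h | h
      · exact Or.inl (Or.inr ⟨-x, ⟨hnx, by omega⟩, by ring⟩)
      · exact Or.inr h
      · exact Or.inl (Or.inl ⟨hx, h⟩)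
    have h1 := card_le_card hsub
    have h2 := card_union_le (P ∪ P.image (- ·)) {0}
    have h3 := card_union_le P (P.image (- ·))
    have h4 : #(P.image (- ·)) ≤ #P := card_image_le
    rw [card_singleton] at h2
    omega
  have hPmem : ∀ x ∈ P, 0 < x ∧ x ≤ m - a ∧ x ∉ A := by
    intro x hx
    obtain ⟨hx, hx0⟩ := mem_filter.1 hx
    obtain ⟨y, hy, z, hz, rfl⟩ := mem_sub.1 hx
    have := hA y hy
    have := hA z hz
    refine ⟨hx0, by omega, fun h => hsf _ h z hz (by simpa using hy)⟩
  have hAP : Disjoint A P := disjoint_left.2 fun x hx hx' => (hPmem x hx').2.2 hx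
  have hAPcard : (#A : ℤ) + #P ≤ m := by
    have hsub : A ∪ P ⊆ Icc 1 m := by
      intro x hx
      rw [mem_Icc]
      rcases mem_union.1 hx with hx | hx
      · have := hA x hx
        omega
      · have := hPmem x hx
        omega
    have := card_le_card hsub
    rw [card_union_of_disjoint hAP, Int.card_Icc] at this
    omega
  set M := A.filter fun x => x ≤ m - a - a with hM
  have hMcard : (#A : ℤ) ≤ a + #M := by
    have h := card_filter_add_card_filter_not (s := A) (fun x => x ≤ m - a - a)
    have h' := card_filter_le_of_add_notMem ha.le (fun x hx => hsf x hx a haA) (m - a)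
    have hsub : (A.filter fun x => ¬ x ≤ m - a - a) ⊆
        A.filter fun x => m - a - a < x ∧ x ≤ m - a + a := by
      intro x hx
      simp only [mem_filter] at hx ⊢
      have := hA x hx.1
      exact ⟨hx.1, by omega, by omega⟩
    have := card_le_card hsub
    rw [← hM] at h
    omega
  have hMle : (#M : ℤ) ≤ m - 3 * a + 1 := by
    have hsub : M ⊆ Icc a (m - a - a) := by
      intro x hx
      obtain ⟨hx, hxm⟩ := mem_filter.1 hx
      exact mem_Icc.2 ⟨(hA x hx).1, hxm⟩
    have := card_le_card hsub
    rw [Int.card_Icc] at this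
    omega
  have hhole : ∀ t : ℤ, 0 ≤ t → t ≤ 2 * #A - (m - a) - 2 → m - a + t ∉ A := by
    intro t ht0 ht hmem
    have h1 := two_mul_card_filter_le (A := A) (s := m - a + t)
      (fun x hx y hy h => hsf x hx y hy (h ▸ hmem)) (a + t)
    have hsub : M ⊆ (A.filter fun x => a + t ≤ x ∧ x ≤ m - a + t - (a + t)) ∪ Ico a (a + t) := by
      intro x hx
      obtain ⟨hx, hxm⟩ := mem_filter.1 hx
      have := hA x hx
      simp only [mem_union, mem_filter, mem_Ico, hx, true_and]
      omega
    have h2 := (card_le_card hsub).trans (card_union_le _ _)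
    rw [Int.card_Ico] at h2
    omega
  have hlt : 2 * (#A : ℤ) - 2 < m := by
    by_contra! h
    exact hhole a ha.le (by omega) (by simpa using hmA)
  have hcount : 3 * (#A : ℤ) + #P ≤ 2 * m - a + 2 := by
    have hd : Disjoint (A ∪ P) (Icc (m - a + 1) (2 * #A - 2)) := by
      rw [disjoint_left]
      intro x hx hx'
      rw [mem_Icc] at hx'
      rcases mem_union.1 hx with hx | hx
      · exact hhole (x - (m - a)) (by omega) (by omega) (by simpa using hx)
      · have := hPmem x hx
        omega
    have hsub : (A ∪ P) ∪ Icc (m - a + 1) (2 * #A - 2) ⊆ Icc 1 m := by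
      intro x hx
      rw [mem_Icc]
      rcases mem_union.1 hx with hx | hx
      · rcases mem_union.1 hx with hx | hx
        · have := hA x hx
          omega
        · have := hPmem x hx
          omega
      · rw [mem_Icc] at hx
        omega
    have := card_le_card hsub
    rw [card_union_of_disjoint hd, card_union_of_disjoint hAP, Int.card_Icc, Int.card_Icc] at this
    omega
  omega

/-- Size bound for a subset of `[a, n]` contained in the residue class of `a` modulo `d`. -/
theorem mul_card_le_of_forall_dvd_sub {A : Finset ℕ} {n a d : ℕ} (hA : ∀ x ∈ A, a ≤ x ∧ x ≤ n)
    (hdvd : ∀ x ∈ A, d ∣ x - a) : d * #A ≤ n - a + d := by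
  have hmaps : Set.MapsTo (fun x => (x - a) / d) A (range ((n - a) / d + 1)) := by
    intro x hx
    rw [mem_coe, mem_range, Nat.lt_succ_iff]
    exact Nat.div_le_div_right (Nat.sub_le_sub_right (hA x hx).2 a)
  have hinj : Set.InjOn (fun x => (x - a) / d) A := by
    intro x hx y hy hxy
    have h := Nat.div_left_inj (hdvd x hx) (hdvd y hy) |>.1 hxy
    have := hA x hx
    have := hA y hy
    omega
  have h := card_le_card_of_injOn _ hmaps hinj
  rw [card_range] at h
  calc d * #A ≤ d * ((n - a) / d + 1) := Nat.mul_le_mul_left d h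
    _ ≤ n - a + d := by
      have := Nat.mul_div_le (n - a) d
      rw [mul_add, mul_one]
      omega

/-- Deshouillers–Freiman–Sós–Temkin structure theorem: every sum-free subset `A`
of `{1,...,n}` satisfies `|A| ≤ 2n/5 + 1`, or consists only of odd numbers,
or satisfies `|A| ≤ min A` (i.e. every element of `A` is at least `|A|`). -/
theorem dfst_structure (n : ℕ) (hn : 1 ≤ n) (A : Finset ℕ)
    (hA : A ⊆ Finset.Icc 1 n)
    (hsf : ∀ x ∈ A, ∀ y ∈ A, x + y ∉ A) :
    ((A.card : ℝ) ≤ 2 * n / 5 + 1) ∨ (∀ x ∈ A, Odd x) ∨ (∀ x ∈ A, A.card ≤ x) := by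
  classical
  suffices h : 5 * #A ≤ 2 * n + 5 ∨ (∀ x ∈ A, Odd x) ∨ (∀ x ∈ A, #A ≤ x) by
    refine h.imp_left fun h => ?_
    have h' : (5 : ℝ) * #A ≤ 2 * n + 5 := by exact_mod_cast h
    linarith
  rcases A.eq_empty_or_nonempty with rfl | hne
  · simp
  set a := A.min' hne
  set m := A.max' hne
  have haA : a ∈ A := A.min'_mem hne
  have hmA : m ∈ A := A.max'_mem hne
  have hbound : ∀ x ∈ A, a ≤ x ∧ x ≤ m := fun x hx => ⟨A.min'_le x hx, A.le_max' x hx⟩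
  have ha1 : 1 ≤ a := (mem_Icc.1 (hA haA)).1
  have hmn : m ≤ n := (mem_Icc.1 (hA hmA)).2
  have hbound' : ∀ x ∈ A, a ≤ x ∧ x ≤ n := fun x hx =>
    ⟨(hbound x hx).1, (hbound x hx).2.trans hmn⟩
  by_cases hgcd : ∀ d : ℕ, (∀ x ∈ A, d ∣ x - a) → d = 1
  · let Z : Finset ℤ := A.map Nat.castEmbedding
    have hZ : ∀ x : ℤ, x ∈ Z ↔ ∃ y ∈ A, (y : ℤ) = x := fun x => by simp [Z]
    have hZcard : #Z = #A := card_map _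
    have key := five_mul_card_le_or_card_le (A := Z) (a := a) (m := m) (by omega)
      ((hZ _).2 ⟨a, haA, rfl⟩) ((hZ _).2 ⟨m, hmA, rfl⟩)
      (fun x hx => by
        obtain ⟨y, hy, rfl⟩ := (hZ x).1 hx
        exact_mod_cast hbound y hy)
      (fun x hx y hy hxy => by
        obtain ⟨u, hu, rfl⟩ := (hZ x).1 hx
        obtain ⟨v, hv, rfl⟩ := (hZ y).1 hy
        obtain ⟨w, hw, huvw⟩ := (hZ _).1 hxy
        have : w = u + v := by exact_mod_cast huvw
        exact hsf u hu v hv (this ▸ hw))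
      (fun d hd => by
        rw [Int.isUnit_iff_natAbs_eq]
        refine hgcd _ fun x hx => ?_
        have := hd x ((hZ _).2 ⟨x, hx, rfl⟩)
        rw [← Nat.cast_sub (hbound x hx).1] at this
        exact Int.natAbs_dvd_natAbs.2 this)
    rw [hZcard] at key
    rcases key with h | h
    · left
      omega
    · exact Or.inr (Or.inr fun x hx => by have := hbound x hx; omega)
  · push Not at hgcd
    obtain ⟨d, hd, hd1⟩ := hgcd
    rcases Nat.lt_or_ge d 3 with hd3 | hd3
    · have hd2 : ∀ x ∈ A, 2 ∣ x - a := fun x hx => by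
        have := hd x hx
        interval_cases d
        · rw [Nat.eq_zero_of_zero_dvd this]
          exact dvd_zero 2
        · exact absurd rfl hd1
        · exact this
      by_cases hao : Odd a
      · refine Or.inr (Or.inl fun x hx => ?_)
        have h1 := hd2 x hx
        have h2 := hbound x hx
        rw [Nat.odd_iff] at hao ⊢
        omega
      · left
        rw [Nat.odd_iff] at hao
        have hdisj : Disjoint A (A.image (· - a)) := by
          rw [disjoint_left]
          intro x hx hx'
          obtain ⟨y, hy, rfl⟩ := mem_image.1 hx'
          have := hbound y hy
          exact hsf _ hx a haA (by rwa [Nat.sub_add_cancel this.1])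
        have hcard : #(A.image (· - a)) = #A := card_image_of_injOn fun x hx y hy hxy => by
          have := hbound x hx
          have := hbound y hy
          change x - a = y - a at hxy
          omega
        have := mul_card_le_of_forall_dvd_sub (A := A ∪ A.image (· - a)) (n := n) (a := 0) (d := 2)
          (fun x hx => by
            rcases mem_union.1 hx with hx | hx
            · exact ⟨x.zero_le, (hbound' x hx).2⟩
            · obtain ⟨y, hy, rfl⟩ := mem_image.1 hx
              have := hbound' y hy
              exact ⟨Nat.zero_le _, by omega⟩)
          (fun x hx => by
            rcases mem_union.1 hx with hx | hx
            · have := hd2 x hx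
              have := hbound x hx
              omega
            · obtain ⟨y, hy, rfl⟩ := mem_image.1 hx
              exact hd2 y hy)
        rw [card_union_of_disjoint hdisj, hcard] at this
        omega
    · left
      have h := mul_card_le_of_forall_dvd_sub hbound' hd
      by_cases hk : #A ≤ 1
      · omega
      · obtain ⟨e, rfl⟩ := Nat.exists_eq_add_of_le hd3
        have : e * 2 ≤ e * #A := Nat.mul_le_mul_left e (by omega)
        nlinarith [Nat.sub_le n a]
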